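/- arXiv:1506.01503 — 3 statements merged into one kernel-verified Lean document; each statement's English description precedes it below -/
import Mathlib

section
/- Under the standing assumptions (block lower-triangular Hadamard triple with invariant set 𝒮 ⊆ 𝒵 and L, 𝓛 satisfying the π₂-injectivity property): for every b₁ ∈ π₁(B), the set B₂(b₁) is a complete set of representatives (mod R₂(ℤ^{d−r})); consequently #B₂(b₁) = |det R₂| = #π₂(L) and (R₂, B₂(b₁), π₂(L)) is a Hadamard triple in ℤ^{d−r}. Also, for every ℓ₂ ∈ π₂(L), #L₁(ℓ₂) = #π₁(B) = N/|det R₂|, and (R₁, π₁(B), L₁(ℓ₂)) is a Hadamard triple in ℤ^r. -/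
open MeasureTheory Matrix Filter
open scoped BigOperators Classical

noncomputable section

variable {ι : Type*}

/-- Cast an integer matrix to a real matrix. -/
def intMatCast [Fintype ι] [DecidableEq ι] (R : Matrix ι ι ℤ) : Matrix ι ι ℝ :=
  R.map (Int.cast : ℤ → ℝ)

/-- Cast an integer vector to a real vector. -/
def intVecCast (v : ι → ℤ) : ι → ℝ := fun i => (v i : ℝ)

/-- Standard inner product on `ι → ℝ`. -/
def rdot [Fintype ι] (x y : ι → ℝ) : ℝ := ∑ i, x i * y i

/-- The exponential `e^{2πi⟨x,y⟩}`. -/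
def expv [Fintype ι] (x y : ι → ℝ) : ℂ :=
  Complex.exp (2 * (Real.pi : ℂ) * Complex.I * (rdot x y : ℝ))

/-- An integer matrix is expanding if all of its (complex) eigenvalues have modulus
strictly greater than `1`. -/
def IsExpanding [Fintype ι] [DecidableEq ι] (R : Matrix ι ι ℤ) : Prop :=
  ∀ z ∈ spectrum ℂ (R.map (Int.cast : ℤ → ℂ)), 1 < ‖z‖

/-- `(R,B,L)` is a Hadamard triple: `#B = #L` and the matrix
`(1/√N)(e^{2πi⟨R⁻¹b,ℓ⟩})_{ℓ∈L,b∈B}` is unitary, expressed via orthonormality of columns. -/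
def IsHadamardTriple [Fintype ι] [DecidableEq ι] (R : Matrix ι ι ℤ)
    (B L : Finset (ι → ℤ)) : Prop :=
  B.card = L.card ∧
  ∀ b ∈ B, ∀ b' ∈ B,
    (B.card : ℂ)⁻¹ * ∑ l ∈ L,
      expv ((intMatCast R)⁻¹.mulVec (intVecCast b)) (intVecCast l) *
        (starRingEnd ℂ) (expv ((intMatCast R)⁻¹.mulVec (intVecCast b')) (intVecCast l)) =
    if b = b' then 1 else 0

/-- `μ` is the self-affine measure `μ(R,B)`: a compactly supported Borel probability
measure satisfying `μ(E) = (1/N) ∑_{b∈B} μ(τ_b⁻¹(E))` where `τ_b(x) = R⁻¹(x+b)`. -/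
def IsSelfAffineMeasure [Fintype ι] [DecidableEq ι] (R : Matrix ι ι ℤ)
    (B : Finset (ι → ℤ)) (μ : Measure (ι → ℝ)) : Prop :=
  IsProbabilityMeasure μ ∧ (∃ K : Set (ι → ℝ), IsCompact K ∧ μ Kᶜ = 0) ∧
  ∀ E : Set (ι → ℝ), MeasurableSet E →
    μ E = (B.card : ENNReal)⁻¹ *
      ∑ b ∈ B, μ ((fun x => (intMatCast R)⁻¹.mulVec (x + intVecCast b)) ⁻¹' E)

/-- `Λ` is a spectrum for `μ`: it is countable and the exponentials `e^{2πi⟨λ,·⟩}`, `λ ∈ Λ`,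
form an orthonormal basis of `L²(μ)` (orthonormal and total). -/
def IsSpectrum [Fintype ι] [DecidableEq ι] (μ : Measure (ι → ℝ)) (Λ : Set (ι → ℝ)) : Prop :=
  Λ.Countable ∧
  (∀ l ∈ Λ, ∀ l' ∈ Λ,
    ∫ x, expv l x * (starRingEnd ℂ) (expv l' x) ∂μ = if l = l' then 1 else 0) ∧
  (∀ f : Lp ℂ 2 μ, (∀ l ∈ Λ, ∫ x, (starRingEnd ℂ) (expv l x) * f x ∂μ = 0) → f = 0)

/-- The Fourier transform `μ̂(ξ) = ∫ e^{-2πi⟨ξ,x⟩} dμ(x)`. -/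
def ftMeasure [Fintype ι] (μ : Measure (ι → ℝ)) (ξ : ι → ℝ) : ℂ :=
  ∫ x, Complex.exp (-(2 * (Real.pi : ℂ) * Complex.I * (rdot ξ x : ℝ))) ∂μ

/-- `u_B(x) = |(1/N) ∑_{b∈B} e^{2πi⟨b,x⟩}|²`. -/
def uB [Fintype ι] (B : Finset (ι → ℤ)) (x : ι → ℝ) : ℝ :=
  ‖(B.card : ℂ)⁻¹ * ∑ b ∈ B, expv (intVecCast b) x‖ ^ 2

/-- `𝒵 = {ξ : μ̂(ξ + k) = 0 for all k ∈ ℤ^d}`. -/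
def Zset [Fintype ι] (μ : Measure (ι → ℝ)) : Set (ι → ℝ) :=
  {ξ | ∀ k : ι → ℤ, ftMeasure μ (ξ + intVecCast k) = 0}

/-- `ℤ[R,B]`: the smallest `R`-invariant subgroup of `ℤ^d` containing all `R^j b`. -/
def ZRB [Fintype ι] [DecidableEq ι] (R : Matrix ι ι ℤ) (B : Finset (ι → ℤ)) :
    AddSubgroup (ι → ℤ) :=
  AddSubgroup.closure {v | ∃ (j : ℕ) (b : ι → ℤ), b ∈ B ∧ v = (R ^ j).mulVec b}

/-- `𝓛` is a complete set of representatives modulo `S(ℤ^d)`. -/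
def IsCompleteResidueSet [Fintype ι] [DecidableEq ι] (S : Matrix ι ι ℤ)
    (𝓛 : Finset (ι → ℤ)) : Prop :=
  ∀ v : ι → ℤ, ∃! l, l ∈ 𝓛 ∧ ∃ k : ι → ℤ, v - l = S.mulVec k


/-- First-component projection `π₁`. -/
def proj1 {r s : ℕ} {α : Type*} (x : Fin r ⊕ Fin s → α) : Fin r → α := x ∘ Sum.inl

/-- Second-component projection `π₂`. -/
def proj2 {r s : ℕ} {α : Type*} (x : Fin r ⊕ Fin s → α) : Fin s → α := x ∘ Sum.inr

/-- `π₁(A)` for a finite set `A`. -/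
def proj1Set {r s : ℕ} (A : Finset (Fin r ⊕ Fin s → ℤ)) : Finset (Fin r → ℤ) :=
  A.image proj1

/-- `π₂(A)` for a finite set `A`. -/
def proj2Set {r s : ℕ} (A : Finset (Fin r ⊕ Fin s → ℤ)) : Finset (Fin s → ℤ) :=
  A.image proj2

/-- `A₁(x₂) = {x ∈ ℤ^r : (x,x₂)ᵀ ∈ A}`. -/
def slice1 {r s : ℕ} (A : Finset (Fin r ⊕ Fin s → ℤ)) (x₂ : Fin s → ℤ) :
    Finset (Fin r → ℤ) :=
  (A.filter (fun a => proj2 a = x₂)).image proj1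

/-- `A₂(x₁) = {y ∈ ℤ^{d-r} : (x₁,y)ᵀ ∈ A}`. -/
def slice2 {r s : ℕ} (A : Finset (Fin r ⊕ Fin s → ℤ)) (x₁ : Fin r → ℤ) :
    Finset (Fin s → ℤ) :=
  (A.filter (fun a => proj1 a = x₁)).image proj2

/-- The slab `ℝ^r × {(R₂ᵀ)^k y₀} + ℤ^d`. -/
def slabLevel (r : ℕ) {s : ℕ} (R₂ : Matrix (Fin s) (Fin s) ℤ) (y₀ : Fin s → ℝ) (k : ℕ) :
    Set (Fin r ⊕ Fin s → ℝ) :=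
  {x | ∃ z : Fin r ⊕ Fin s → ℤ,
    proj2 (x - intVecCast z) = ((intMatCast R₂ᵀ) ^ k).mulVec y₀}

lemma expv_add_left' [Fintype ι] (x x' y : ι → ℝ) :
    expv (x + x') y = expv x y * expv x' y := by
  unfold expv rdot
  rw [← Complex.exp_add]
  congr 1
  simp only [Pi.add_apply, add_mul, Finset.sum_add_distrib]
  push_cast
  ring

lemma expv_comm' [Fintype ι] (x y : ι → ℝ) : expv x y = expv y x := by
  unfold expv rdot
  simp only [mul_comm]

lemma expv_add_right' [Fintype ι] (x y y' : ι → ℝ) :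
    expv x (y + y') = expv x y * expv x y' := by
  rw [expv_comm', expv_add_left', expv_comm' y, expv_comm' y']

lemma expv_zero_left' [Fintype ι] (y : ι → ℝ) : expv 0 y = 1 := by
  simp [expv, rdot]

lemma expv_zero_right' [Fintype ι] (y : ι → ℝ) : expv y 0 = 1 := by
  simp [expv, rdot]

lemma expv_ne_zero' [Fintype ι] (x y : ι → ℝ) : expv x y ≠ 0 := Complex.exp_ne_zero _

lemma expv_conj' [Fintype ι] (x y : ι → ℝ) :
    (starRingEnd ℂ) (expv x y) = expv (-x) y := by
  unfold expv rdot
  rw [← Complex.exp_conj]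
  congr 1
  simp
  exact Or.inl (map_ofNat _ 2)

lemma expv_mul_conj' [Fintype ι] (x x' y : ι → ℝ) :
    expv x y * (starRingEnd ℂ) (expv x' y) = expv (x - x') y := by
  rw [expv_conj', sub_eq_add_neg, expv_add_left']

lemma expv_mul_conj_right' [Fintype ι] (x y y' : ι → ℝ) :
    expv x y * (starRingEnd ℂ) (expv x y') = expv x (y - y') := by
  rw [expv_comm' x y, expv_comm' x y', expv_mul_conj', expv_comm']

lemma expv_int' [Fintype ι] (v w : ι → ℤ) : expv (intVecCast v) (intVecCast w) = 1 := by
  unfold expv rdot intVecCast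
  rw [Complex.exp_eq_one_iff]
  refine ⟨∑ i, v i * w i, ?_⟩
  push_cast
  ring

lemma intVecCast_add' (v w : ι → ℤ) : intVecCast (v + w) = intVecCast v + intVecCast w := by
  ext i; simp [intVecCast]

lemma intVecCast_sub' (v w : ι → ℤ) : intVecCast (v - w) = intVecCast v - intVecCast w := by
  ext i; simp [intVecCast]

lemma intVecCast_inj' {v w : ι → ℤ} (h : intVecCast v = intVecCast w) : v = w := by
  ext i; simpa [intVecCast] using congrFun h i

lemma intVecCast_mulVec' [Fintype ι] [DecidableEq ι] (R : Matrix ι ι ℤ) (v : ι → ℤ) :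
    intVecCast (R.mulVec v) = (intMatCast R).mulVec (intVecCast v) := by
  ext i
  simp [intVecCast, intMatCast, Matrix.mulVec, dotProduct]

/-- If all pairings with integer vectors are trivial, the vector is integral. -/
lemma integral_of_expv_eq_one' [Fintype ι] [DecidableEq ι] (x : ι → ℝ)
    (h : ∀ w : ι → ℤ, expv x (intVecCast w) = 1) : ∃ k : ι → ℤ, x = intVecCast k := by
  have h1 : ∀ i, ∃ n : ℤ, x i = n := by
    intro i
    have := h (Pi.single i 1)
    unfold expv at this
    rw [Complex.exp_eq_one_iff] at this
    obtain ⟨n, hn⟩ := this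
    refine ⟨n, ?_⟩
    have h2 : rdot x (intVecCast (Pi.single i 1)) = x i := by
      unfold rdot intVecCast
      rw [Finset.sum_eq_single i]
      · simp
      · intro j _ hj; simp [hj]
      · simp
    rw [h2] at hn
    have h3 : (2 * (Real.pi : ℂ) * Complex.I) ≠ 0 := by
      simp [Real.pi_ne_zero]
    rw [mul_comm] at hn
    have := mul_right_cancel₀ h3 hn
    exact_mod_cast this
  choose k hk using h1
  exact ⟨k, funext hk⟩

lemma det_ne_zero_of_expanding' [Fintype ι] [DecidableEq ι] (R : Matrix ι ι ℤ)
    (h : IsExpanding R) : R.det ≠ 0 := by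
  intro h0
  have : (0 : ℂ) ∈ spectrum ℂ (R.map (Int.cast : ℤ → ℂ)) := by
    rw [spectrum.zero_mem_iff, Matrix.isUnit_iff_isUnit_det]
    have : (R.map (Int.cast : ℤ → ℂ)).det = ((R.det : ℤ) : ℂ) := by
      have := RingHom.map_det (Int.castRingHom ℂ) R
      simpa using this.symm
    rw [this, h0]
    simp
  have := h 0 this
  simp at this
  linarith

lemma isUnit_intMatCast_det' [Fintype ι] [DecidableEq ι] (R : Matrix ι ι ℤ)
    (h : R.det ≠ 0) : IsUnit (intMatCast R).det := by
  have : (intMatCast R).det = ((R.det : ℤ) : ℝ) := by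
    have := RingHom.map_det (Int.castRingHom ℝ) R
    simpa [intMatCast] using this.symm
  rw [this, isUnit_iff_ne_zero]
  exact_mod_cast h

lemma inv_mulVec_eq' [Fintype ι] [DecidableEq ι] (A : Matrix ι ι ℝ) (h : IsUnit A.det)
    (v w : ι → ℝ) (hv : A.mulVec w = v) : A⁻¹.mulVec v = w := by
  rw [← hv, Matrix.mulVec_mulVec, Matrix.nonsing_inv_mul _ h, Matrix.one_mulVec]

lemma mulVec_inv' [Fintype ι] [DecidableEq ι] (A : Matrix ι ι ℝ) (h : IsUnit A.det)
    (v : ι → ℝ) : A.mulVec (A⁻¹.mulVec v) = v := by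
  rw [Matrix.mulVec_mulVec, Matrix.mul_nonsing_inv _ h, Matrix.one_mulVec]

lemma intMatCast_transpose' [Fintype ι] [DecidableEq ι] (R : Matrix ι ι ℤ) :
    intMatCast Rᵀ = (intMatCast R)ᵀ := rfl

lemma rdot_transpose_inv' [Fintype ι] [DecidableEq ι] (A : Matrix ι ι ℝ) (x y : ι → ℝ) :
    rdot x (Aᵀ⁻¹.mulVec y) = rdot (A⁻¹.mulVec x) y := by
  change x ⬝ᵥ _ = _ ⬝ᵥ y
  rw [← Matrix.transpose_nonsing_inv, Matrix.mulVec_transpose, dotProduct_comm,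
    ← Matrix.dotProduct_mulVec, dotProduct_comm]

lemma expv_transpose_inv' [Fintype ι] [DecidableEq ι] (A : Matrix ι ι ℝ) (x y : ι → ℝ) :
    expv x (Aᵀ⁻¹.mulVec y) = expv (A⁻¹.mulVec x) y := by
  unfold expv; rw [rdot_transpose_inv']

/-- The sublattice `S ℤ^ι`. -/
def latt [Fintype ι] [DecidableEq ι] (S : Matrix ι ι ℤ) : Submodule ℤ (ι → ℤ) :=
  LinearMap.range (Matrix.toLin' S)

lemma mem_latt' [Fintype ι] [DecidableEq ι] (S : Matrix ι ι ℤ) (v : ι → ℤ) :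
    v ∈ latt S ↔ ∃ k, v = S.mulVec k := by
  unfold latt
  simp only [LinearMap.mem_range, Matrix.toLin'_apply]
  exact ⟨fun ⟨k, h⟩ => ⟨k, h.symm⟩, fun ⟨k, h⟩ => ⟨k, h.symm⟩⟩

lemma card_latt' [Fintype ι] [DecidableEq ι] (S : Matrix ι ι ℤ) (h : S.det ≠ 0) :
    Nat.card ((ι → ℤ) ⧸ latt S) = S.det.natAbs := by
  have hinj : Function.Injective (Matrix.toLin' S) := by
    rw [Matrix.toLin'_apply']
    exact Matrix.mulVec_injective_of_det_ne_zero h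
  let e : (ι → ℤ) ≃ₗ[ℤ] latt S := LinearEquiv.ofInjective _ hinj
  rw [← Submodule.natAbs_det_equiv (latt S) e]
  congr 1
  rw [← LinearMap.det_toLin']
  congr 1

lemma orth_swap' {α β : Type*} [DecidableEq α] [DecidableEq β] (L : Finset α) (B : Finset β) (hc : B.card = L.card)
    (f : α → β → ℂ) (n : ℂ) (hn : n ≠ 0)
    (h : ∀ b ∈ B, ∀ b' ∈ B, ∑ l ∈ L, f l b * (starRingEnd ℂ) (f l b') =
      if b = b' then n else 0) :
    ∀ l ∈ L, ∀ l' ∈ L, ∑ b ∈ B, f l b * (starRingEnd ℂ) (f l' b) =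
      if l = l' then n else 0 := by
  let U : Matrix B L ℂ := fun b l => f l b
  let V : Matrix L B ℂ := fun l b => n⁻¹ * (starRingEnd ℂ) (f l b)
  have hUV : U * V = 1 := by
    ext b b'
    have := h b b.2 b' b'.2
    rw [Matrix.mul_apply]
    simp only [U, V]
    calc ∑ l : L, f l b * (n⁻¹ * (starRingEnd ℂ) (f l b'))
        = n⁻¹ * ∑ l : L, f l b * (starRingEnd ℂ) (f l b') := by
          rw [Finset.mul_sum]; exact Finset.sum_congr rfl fun _ _ => by ring
      _ = n⁻¹ * ∑ l ∈ L, f l b * (starRingEnd ℂ) (f l b') := by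
          rw [← Finset.sum_coe_sort L]
      _ = _ := by
          rw [this, Matrix.one_apply]
          simp only [Subtype.ext_iff]
          split_ifs <;> simp [hn]
  have hVU : V * U = 1 := (Matrix.mul_eq_one_comm_of_card_eq _ _ _ (by simpa using hc)).1 hUV
  intro l hl l' hl'
  have := congrFun (congrFun hVU ⟨l', hl'⟩) ⟨l, hl⟩
  rw [Matrix.mul_apply] at this
  simp only [U, V] at this
  calc ∑ b ∈ B, f l b * (starRingEnd ℂ) (f l' b)
      = n * ∑ b : B, n⁻¹ * (starRingEnd ℂ) (f l' b) * f l b := by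
        rw [← Finset.sum_coe_sort B, Finset.mul_sum]
        refine Finset.sum_congr rfl fun _ _ => by field_simp
    _ = _ := by
        rw [this, Matrix.one_apply]
        simp only [Subtype.ext_iff, eq_comm]
        split_ifs <;> simp

lemma orth_card' {α β : Type*} [DecidableEq α] [DecidableEq β] (L : Finset α) (B : Finset β)
    (f : α → β → ℂ) (n : ℂ) (hn : n ≠ 0)
    (h : ∀ l ∈ L, ∀ l' ∈ L, ∑ b ∈ B, f l b * (starRingEnd ℂ) (f l' b) =
      if l = l' then n else 0) : L.card ≤ B.card := by
  let U : Matrix L B ℂ := fun l b => f l b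
  let V : Matrix B L ℂ := fun b l => n⁻¹ * (starRingEnd ℂ) (f l b)
  have hUV : U * V = 1 := by
    ext l l'
    have := h l l.2 l' l'.2
    rw [Matrix.mul_apply]
    simp only [U, V]
    calc ∑ b : B, f l b * (n⁻¹ * (starRingEnd ℂ) (f l' b))
        = n⁻¹ * ∑ b : B, f l b * (starRingEnd ℂ) (f l' b) := by
          rw [Finset.mul_sum]; exact Finset.sum_congr rfl fun _ _ => by ring
      _ = n⁻¹ * ∑ b ∈ B, f l b * (starRingEnd ℂ) (f l' b) := by
          rw [← Finset.sum_coe_sort B]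
      _ = _ := by
          rw [this, Matrix.one_apply]
          simp only [Subtype.ext_iff]
          split_ifs <;> simp [hn]
  have h1 := Matrix.rank_mul_le_left U V
  rw [hUV, Matrix.rank_one] at h1
  have := h1.trans U.rank_le_card_width
  simpa using this

/-- Linear independence of the characters `x ↦ e^{2πi⟨b,x⟩}` on `ℝ^ι`. -/
lemma expv_indep' [Fintype ι] [DecidableEq ι] (S : Finset (ι → ℤ)) (c : (ι → ℤ) → ℂ)
    (h : ∀ x : ι → ℝ, ∑ b ∈ S, c b * expv (intVecCast b) x = 0) : ∀ b ∈ S, c b = 0 := by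
  let χ : (ι → ℤ) → (Multiplicative (ι → ℝ) →* ℂ) := fun b =>
    { toFun := fun x => expv (intVecCast b) x.toAdd
      map_one' := by simp [expv_zero_right']
      map_mul' := fun x y => by simp [expv_add_right'] }
  have hχ : Function.Injective χ := by
    intro b b' hb
    by_contra hne
    obtain ⟨i, hi⟩ := Function.ne_iff.1 hne
    have hx : ∀ x : ι → ℝ, expv (intVecCast b) x = expv (intVecCast b') x := fun x =>
      DFunLike.congr_fun hb (Multiplicative.ofAdd x)
    have h1 : ∀ x : ι → ℝ, expv (intVecCast b - intVecCast b') x = 1 := by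
      intro x
      rw [← expv_mul_conj', hx, expv_mul_conj', sub_self, expv_zero_left']
    have hd : ((b i : ℝ) - b' i) ≠ 0 := by
      rw [sub_ne_zero]; exact_mod_cast hi
    have h2 := h1 (Pi.single i (1 / 2 / ((b i : ℝ) - b' i)))
    have h3 : rdot (intVecCast b - intVecCast b')
        (Pi.single i (1 / 2 / ((b i : ℝ) - b' i))) = 1 / 2 := by
      unfold rdot intVecCast
      rw [Finset.sum_eq_single i]
      · simp; field_simp
      · intro j _ hj; simp [hj]
      · simp
    unfold expv at h2
    rw [h3] at h2
    have : (2 * (Real.pi : ℂ) * Complex.I * ((1 / 2 : ℝ) : ℂ)) = Real.pi * Complex.I := by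
      push_cast; ring
    rw [this, Complex.exp_pi_mul_I] at h2
    norm_num at h2
  have hli := (linearIndependent_monoidHom (Multiplicative (ι → ℝ)) ℂ).comp χ hχ
  rw [linearIndependent_iff'] at hli
  refine hli S c ?_
  ext x
  simpa [χ] using h x.toAdd

lemma expv_congr_latt' [Fintype ι] [DecidableEq ι] (R : Matrix ι ι ℤ) (hR : R.det ≠ 0)
    (k g g' : ι → ℤ) (h : g - g' ∈ latt Rᵀ) :
    expv ((intMatCast R)⁻¹.mulVec (intVecCast k)) (intVecCast g) =
    expv ((intMatCast R)⁻¹.mulVec (intVecCast k)) (intVecCast g') := by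
  obtain ⟨j, hj⟩ := (mem_latt' _ _).1 h
  have : g = Rᵀ.mulVec j + g' := by rw [← hj]; abel
  have hu : IsUnit ((intMatCast R)ᵀ).det := by
    rw [Matrix.det_transpose]; exact isUnit_intMatCast_det' R hR
  rw [this, intVecCast_add', expv_add_right', ← expv_transpose_inv' _ _ (intVecCast (Rᵀ *ᵥ j)),
    intVecCast_mulVec', intMatCast_transpose', inv_mulVec_eq' _ hu _ _ rfl, expv_int', one_mul]

lemma expv_of_mem_latt' [Fintype ι] [DecidableEq ι] (R : Matrix ι ι ℤ) (hR : R.det ≠ 0)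
    (k g : ι → ℤ) (h : k ∈ latt R) :
    expv ((intMatCast R)⁻¹.mulVec (intVecCast k)) (intVecCast g) = 1 := by
  obtain ⟨j, hj⟩ := (mem_latt' _ _).1 h
  rw [hj, intVecCast_mulVec', inv_mulVec_eq' _ (isUnit_intMatCast_det' R hR) _ _ rfl, expv_int']

lemma finite_quot' [Fintype ι] [DecidableEq ι] (S : Matrix ι ι ℤ) (h : S.det ≠ 0) :
    Finite ((ι → ℤ) ⧸ latt S) := by
  refine Nat.finite_of_card_ne_zero ?_
  rw [card_latt' S h]
  simpa using h

lemma char_sum' [Fintype ι] [DecidableEq ι] (R : Matrix ι ι ℤ) (hR : R.det ≠ 0)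
    [Fintype ((ι → ℤ) ⧸ latt Rᵀ)] (k : ι → ℤ) (hk : k ∉ latt R) :
    ∑ q : (ι → ℤ) ⧸ latt Rᵀ,
      expv ((intMatCast R)⁻¹.mulVec (intVecCast k)) (intVecCast q.out) = 0 := by
  by_contra hne
  apply hk
  have key : ∀ w : ι → ℤ,
      expv ((intMatCast R)⁻¹.mulVec (intVecCast k)) (intVecCast w) = 1 := by
    intro w
    have h1 : ∑ q : (ι → ℤ) ⧸ latt Rᵀ,
        expv ((intMatCast R)⁻¹.mulVec (intVecCast k))
          (intVecCast (q + Submodule.Quotient.mk w).out) =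
        ∑ q : (ι → ℤ) ⧸ latt Rᵀ,
          expv ((intMatCast R)⁻¹.mulVec (intVecCast k)) (intVecCast q.out) :=
      Equiv.sum_comp (Equiv.addRight (Submodule.Quotient.mk w : (ι → ℤ) ⧸ latt Rᵀ))
        (fun q => expv ((intMatCast R)⁻¹.mulVec (intVecCast k)) (intVecCast q.out))
    have h2 : ∀ q : (ι → ℤ) ⧸ latt Rᵀ,
        expv ((intMatCast R)⁻¹.mulVec (intVecCast k))
          (intVecCast (q + Submodule.Quotient.mk w).out) =
        expv ((intMatCast R)⁻¹.mulVec (intVecCast k)) (intVecCast q.out) *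
        expv ((intMatCast R)⁻¹.mulVec (intVecCast k)) (intVecCast w) := by
      intro q
      rw [← expv_add_right', ← intVecCast_add']
      apply expv_congr_latt' R hR
      rw [← Submodule.Quotient.eq]
      have e1 : ∀ p : (ι → ℤ) ⧸ latt Rᵀ, Submodule.Quotient.mk p.out = p := fun p =>
        Quotient.out_eq' p
      rw [e1, Submodule.Quotient.mk_add, e1]
    simp_rw [h2] at h1
    rw [← Finset.sum_mul] at h1
    exact mul_left_cancel₀ hne (by rw [h1, mul_one])
  obtain ⟨j, hj⟩ := integral_of_expv_eq_one' _ key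
  rw [mem_latt']
  refine ⟨j, intVecCast_inj' ?_⟩
  rw [intVecCast_mulVec', ← hj, mulVec_inv' _ (isUnit_intMatCast_det' R hR)]

lemma complete_of_vanishing' [Fintype ι] [DecidableEq ι] (R : Matrix ι ι ℤ) (hR : R.det ≠ 0)
    (B : Finset (ι → ℤ)) (hB : B.Nonempty) (w : (ι → ℤ) → ℂ) (hw : ∀ b, w b ≠ 0)
    (hdist : ∀ b ∈ B, ∀ b' ∈ B, b - b' ∈ latt R → b = b')
    (hv : ∀ g : ι → ℤ, g ∉ latt Rᵀ →
      ∑ b ∈ B, w b * expv ((intMatCast R)⁻¹.mulVec (intVecCast b)) (intVecCast g) = 0) :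
    IsCompleteResidueSet R B := by
  have hRt : Rᵀ.det ≠ 0 := by rwa [Matrix.det_transpose]
  have _ := finite_quot' Rᵀ hRt
  let _ : Fintype ((ι → ℤ) ⧸ latt Rᵀ) := Fintype.ofFinite _
  have e1 : ∀ p : (ι → ℤ) ⧸ latt Rᵀ, Submodule.Quotient.mk p.out = p := fun p =>
    Quotient.out_eq' p
  have main : ∀ v : ι → ℤ,
      ∑ b ∈ B, w b = ∑ b ∈ B, w b * ∑ q : (ι → ℤ) ⧸ latt Rᵀ,
        expv ((intMatCast R)⁻¹.mulVec (intVecCast (b - v))) (intVecCast q.out) := by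
    intro v
    have h1 : ∀ q : (ι → ℤ) ⧸ latt Rᵀ,
        ∑ b ∈ B, w b * expv ((intMatCast R)⁻¹.mulVec (intVecCast (b - v))) (intVecCast q.out) =
        if q = 0 then ∑ b ∈ B, w b else 0 := by
      intro q
      split_ifs with hq
      · refine Finset.sum_congr rfl fun b _ => ?_
        have : q.out - 0 ∈ latt Rᵀ := by
          rw [← Submodule.Quotient.eq, e1, hq]; rfl
        rw [expv_congr_latt' R hR _ _ 0 this]
        have : (intVecCast (0 : ι → ℤ)) = 0 := by ext; simp [intVecCast]
        rw [this, expv_zero_right', mul_one]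
      · have : q.out ∉ latt Rᵀ := by
          intro h
          apply hq
          rw [← e1 q]
          exact (Submodule.Quotient.mk_eq_zero _).2 h
        have h2 := hv _ this
        calc _ = (∑ b ∈ B, w b * expv ((intMatCast R)⁻¹.mulVec (intVecCast b))
              (intVecCast q.out)) * (starRingEnd ℂ)
              (expv ((intMatCast R)⁻¹.mulVec (intVecCast v)) (intVecCast q.out)) := by
              rw [Finset.sum_mul]
              refine Finset.sum_congr rfl fun b _ => ?_
              rw [mul_assoc, expv_mul_conj', intVecCast_sub', Matrix.mulVec_sub]
          _ = 0 := by rw [h2, zero_mul]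
    simp_rw [Finset.mul_sum]
    rw [Finset.sum_comm]
    simp_rw [h1]
    simp
  have hzero : ∀ v, (∀ b ∈ B, b - v ∉ latt R) → ∑ b ∈ B, w b = 0 := by
    intro v h
    rw [main v]
    refine Finset.sum_eq_zero fun b hb => ?_
    rw [char_sum' R hR _ (h b hb), mul_zero]
  have hne : ∑ b ∈ B, w b ≠ 0 := by
    obtain ⟨b₀, hb₀⟩ := hB
    rw [main b₀, Finset.sum_eq_single b₀]
    · refine mul_ne_zero (hw _) ?_
      simp_rw [fun g => expv_of_mem_latt' R hR (b₀ - b₀) g (by simp)]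
      simp
    · intro b hb hbne
      rw [char_sum' R hR _ (fun h => hbne (hdist b hb b₀ hb₀ h)), mul_zero]
    · intro h; exact absurd hb₀ h
  intro v
  have : ∃ b ∈ B, b - v ∈ latt R := by
    by_contra h
    push Not at h
    exact hne (hzero v h)
  obtain ⟨b, hb, hbv⟩ := this
  refine ⟨b, ⟨hb, ?_⟩, ?_⟩
  · rw [← mem_latt', ← neg_sub]; exact neg_mem hbv
  · rintro b' ⟨hb', hk⟩
    rw [← mem_latt'] at hk
    apply hdist b' hb' b hb
    have := neg_mem (add_mem hk hbv)
    convert this using 1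
    abel

lemma card_complete' [Fintype ι] [DecidableEq ι] (R : Matrix ι ι ℤ) (hR : R.det ≠ 0)
    (B : Finset (ι → ℤ)) (h : IsCompleteResidueSet R B) : B.card = R.det.natAbs := by
  rw [← card_latt' R hR, ← Nat.card_eq_finsetCard B]
  refine Nat.card_eq_of_bijective
    (fun b : B => (Submodule.Quotient.mk (b : ι → ℤ) : (ι → ℤ) ⧸ latt R)) ⟨?_, ?_⟩
  · intro b b' hbb
    have hm := (Submodule.Quotient.eq _).1 hbb
    obtain ⟨c, _, hc⟩ := h b
    have h1 := hc b ⟨b.2, 0, by simp⟩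
    have h2 := hc b' ⟨b'.2, (mem_latt' _ _).1 hm⟩
    exact Subtype.ext (h1.trans h2.symm)
  · intro q
    obtain ⟨v, rfl⟩ := Submodule.Quotient.mk_surjective _ q
    obtain ⟨c, ⟨hc, hk⟩, _⟩ := h v
    refine ⟨⟨c, hc⟩, ?_⟩
    symm
    exact (Submodule.Quotient.eq _).2 ((mem_latt' _ _).2 hk)

lemma card_le_of_inj' [Fintype ι] [DecidableEq ι] (R : Matrix ι ι ℤ) (hR : R.det ≠ 0)
    (B : Finset (ι → ℤ)) (h : ∀ b ∈ B, ∀ b' ∈ B, b - b' ∈ latt R → b = b') :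
    B.card ≤ R.det.natAbs := by
  have _ := finite_quot' R hR
  rw [← card_latt' R hR, ← Nat.card_eq_finsetCard B]
  refine Nat.card_le_card_of_injective
    (fun b : B => (Submodule.Quotient.mk (b : ι → ℤ) : (ι → ℤ) ⧸ latt R)) ?_
  intro b b' hbb
  exact Subtype.ext (h b b.2 b' b'.2 ((Submodule.Quotient.eq _).1 hbb))

lemma rdot_split' {r s : ℕ} (x y : Fin r ⊕ Fin s → ℝ) :
    rdot x y = rdot (proj1 x) (proj1 y) + rdot (proj2 x) (proj2 y) := by
  simp [rdot, proj1, proj2, Fintype.sum_sum_type]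

lemma expv_split' {r s : ℕ} (x y : Fin r ⊕ Fin s → ℝ) :
    expv x y = expv (proj1 x) (proj1 y) * expv (proj2 x) (proj2 y) := by
  unfold expv
  rw [← Complex.exp_add, rdot_split']
  congr 1
  push_cast
  ring

lemma ext_proj' {r s : ℕ} {α : Type*} {x y : Fin r ⊕ Fin s → α} (h1 : proj1 x = proj1 y)
    (h2 : proj2 x = proj2 y) : x = y := by
  ext i
  rcases i with i | i
  · exact congrFun h1 i
  · exact congrFun h2 i

lemma intMatCast_blocks' {r s : ℕ} (R₁ : Matrix (Fin r) (Fin r) ℤ)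
    (R₂ : Matrix (Fin s) (Fin s) ℤ) (C : Matrix (Fin s) (Fin r) ℤ) :
    intMatCast (Matrix.fromBlocks R₁ 0 C R₂) =
      Matrix.fromBlocks (intMatCast R₁) 0 (C.map (Int.cast : ℤ → ℝ)) (intMatCast R₂) := by
  unfold intMatCast
  rw [Matrix.fromBlocks_map]
  simp

lemma block_inv1' {r s : ℕ} (A₁ : Matrix (Fin r) (Fin r) ℝ)
    (A₂ : Matrix (Fin s) (Fin s) ℝ) (C : Matrix (Fin s) (Fin r) ℝ)
    (h1 : IsUnit A₁.det) (h2 : IsUnit A₂.det) (v : Fin r ⊕ Fin s → ℝ) :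
    proj1 ((Matrix.fromBlocks A₁ 0 C A₂)⁻¹.mulVec v) = A₁⁻¹.mulVec (proj1 v) := by
  have hu : IsUnit (Matrix.fromBlocks A₁ 0 C A₂).det := by
    rw [Matrix.det_fromBlocks_zero₁₂]; exact h1.mul h2
  symm
  apply inv_mulVec_eq' _ h1
  have := mulVec_inv' _ hu v
  conv_rhs => rw [← this]
  rw [Matrix.fromBlocks_mulVec]
  simp [proj1]

lemma block_inv2' {r s : ℕ} (A₁ : Matrix (Fin r) (Fin r) ℝ)
    (A₂ : Matrix (Fin s) (Fin s) ℝ) (C : Matrix (Fin s) (Fin r) ℝ)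
    (h1 : IsUnit A₁.det) (h2 : IsUnit A₂.det) (v : Fin r ⊕ Fin s → ℝ) (hv : proj1 v = 0) :
    proj2 ((Matrix.fromBlocks A₁ 0 C A₂)⁻¹.mulVec v) = A₂⁻¹.mulVec (proj2 v) := by
  have hu : IsUnit (Matrix.fromBlocks A₁ 0 C A₂).det := by
    rw [Matrix.det_fromBlocks_zero₁₂]; exact h1.mul h2
  have h0 := block_inv1' A₁ A₂ C h1 h2 v
  rw [hv, Matrix.mulVec_zero] at h0
  symm
  apply inv_mulVec_eq' _ h2
  have := mulVec_inv' _ hu v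
  conv_rhs => rw [← this]
  rw [Matrix.fromBlocks_mulVec]
  unfold proj1 at h0
  rw [h0]
  simp [proj2]

lemma slice2_sum' {r s : ℕ} (B : Finset (Fin r ⊕ Fin s → ℤ)) (b₁ : Fin r → ℤ)
    (F : (Fin s → ℤ) → ℂ) :
    ∑ b ∈ B.filter (fun a => proj1 a = b₁), F (proj2 b) = ∑ b₂ ∈ slice2 B b₁, F b₂ := by
  unfold slice2
  rw [Finset.sum_image]
  intro x hx y hy hxy
  simp only [Finset.coe_filter, Set.mem_ofPred_eq] at hx hy
  exact ext_proj' (hx.2.trans hy.2.symm) hxy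

lemma slice1_sum' {r s : ℕ} (B : Finset (Fin r ⊕ Fin s → ℤ)) (b₂ : Fin s → ℤ)
    (F : (Fin r → ℤ) → ℂ) :
    ∑ b ∈ B.filter (fun a => proj2 a = b₂), F (proj1 b) = ∑ b₁ ∈ slice1 B b₂, F b₁ := by
  unfold slice1
  rw [Finset.sum_image]
  intro x hx y hy hxy
  simp only [Finset.coe_filter, Set.mem_ofPred_eq] at hx hy
  exact ext_proj' hxy (hx.2.trans hy.2.symm)

lemma sum_proj1' {r s : ℕ} (B : Finset (Fin r ⊕ Fin s → ℤ))
    (F : (Fin r → ℤ) → (Fin s → ℤ) → ℂ) :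
    ∑ b ∈ B, F (proj1 b) (proj2 b) = ∑ b₁ ∈ proj1Set B, ∑ b₂ ∈ slice2 B b₁, F b₁ b₂ := by
  rw [← Finset.sum_fiberwise_of_maps_to (s := B) (t := proj1Set B) (g := proj1)
    (fun b hb => Finset.mem_image_of_mem _ hb)]
  refine Finset.sum_congr rfl fun b₁ _ => ?_
  rw [← slice2_sum']
  refine Finset.sum_congr rfl fun b hb => ?_
  rw [(Finset.mem_filter.1 hb).2]

lemma sum_proj2' {r s : ℕ} (B : Finset (Fin r ⊕ Fin s → ℤ))
    (F : (Fin r → ℤ) → (Fin s → ℤ) → ℂ) :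
    ∑ b ∈ B, F (proj1 b) (proj2 b) = ∑ b₂ ∈ proj2Set B, ∑ b₁ ∈ slice1 B b₂, F b₁ b₂ := by
  rw [← Finset.sum_fiberwise_of_maps_to (s := B) (t := proj2Set B) (g := proj2)
    (fun b hb => Finset.mem_image_of_mem _ hb)]
  refine Finset.sum_congr rfl fun b₂ _ => ?_
  rw [← slice1_sum' B b₂ (fun b₁ => F b₁ b₂)]
  refine Finset.sum_congr rfl fun b hb => ?_
  rw [(Finset.mem_filter.1 hb).2]

lemma mem_slice2' {r s : ℕ} {B : Finset (Fin r ⊕ Fin s → ℤ)} {b₁ : Fin r → ℤ}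
    {b₂ : Fin s → ℤ} (h : b₂ ∈ slice2 B b₁) : ∃ b ∈ B, proj1 b = b₁ ∧ proj2 b = b₂ := by
  unfold slice2 at h
  obtain ⟨b, hb, h2⟩ := Finset.mem_image.1 h
  exact ⟨b, (Finset.mem_filter.1 hb).1, (Finset.mem_filter.1 hb).2, h2⟩

lemma mem_slice1' {r s : ℕ} {B : Finset (Fin r ⊕ Fin s → ℤ)} {b₂ : Fin s → ℤ}
    {b₁ : Fin r → ℤ} (h : b₁ ∈ slice1 B b₂) : ∃ b ∈ B, proj1 b = b₁ ∧ proj2 b = b₂ := by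
  unfold slice1 at h
  obtain ⟨b, hb, h2⟩ := Finset.mem_image.1 h
  exact ⟨b, (Finset.mem_filter.1 hb).1, h2, (Finset.mem_filter.1 hb).2⟩

/-- Each `B₂(b₁)` is a complete residue system mod `R₂(ℤ^{d-r})`,
`#B₂(b₁) = |det R₂| = #π₂(L)`, `(R₂, B₂(b₁), π₂(L))` is a Hadamard triple, and for every
`ℓ₂ ∈ π₂(L)`, `#L₁(ℓ₂) = #π₁(B) = N/|det R₂|` and `(R₁, π₁(B), L₁(ℓ₂))` is a Hadamard
triple. -/
theorem quasi_product_hadamard_components {r s : ℕ}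
    (R₁ : Matrix (Fin r) (Fin r) ℤ) (R₂ : Matrix (Fin s) (Fin s) ℤ)
    (C : Matrix (Fin s) (Fin r) ℤ)
    (R : Matrix (Fin r ⊕ Fin s) (Fin r ⊕ Fin s) ℤ)
    (hRdef : R = Matrix.fromBlocks R₁ 0 C R₂)
    (hR : IsExpanding R) (hR₁ : IsExpanding R₁) (hR₂ : IsExpanding R₂)
    (B : Finset (Fin r ⊕ Fin s → ℤ))
    (μ : Measure (Fin r ⊕ Fin s → ℝ)) (hμ : IsSelfAffineMeasure R B μ)
    (m : ℕ) (hm : 1 ≤ m) (y₀ : Fin s → ℝ)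
    (hy₀ : ∃ k : Fin s → ℤ, ((intMatCast R₂ᵀ) ^ m).mulVec y₀ - y₀ = intVecCast k)
    (hSZ : (⋃ k ∈ Finset.range m, slabLevel r R₂ y₀ k) ⊆ Zset μ)
    (L 𝓛 : Finset (Fin r ⊕ Fin s → ℤ))
    (hH : IsHadamardTriple R B L)
    (hL𝓛 : L ⊆ 𝓛) (h𝓛 : IsCompleteResidueSet Rᵀ 𝓛)
    (hinjL : ∀ l ∈ L, ∀ l' ∈ L,
      (∃ k : Fin s → ℤ, proj2 l - proj2 l' = R₂ᵀ.mulVec k) → proj2 l = proj2 l')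
    (hinj : ∀ l ∈ 𝓛, ∀ l' ∈ 𝓛,
      (∃ k : Fin s → ℤ, proj2 l - proj2 l' = R₂ᵀ.mulVec k) → proj2 l = proj2 l')
    (htrans : ∀ k, 1 ≤ k → k ≤ m → ∀ z ∈ slabLevel r R₂ y₀ k, ∀ l ∈ 𝓛,
      0 < uB B ((intMatCast Rᵀ)⁻¹.mulVec (z + intVecCast l)) →
      (intMatCast Rᵀ)⁻¹.mulVec (z + intVecCast l) ∈ slabLevel r R₂ y₀ (k - 1)) :
    (∀ b₁ ∈ proj1Set B,
      IsCompleteResidueSet R₂ (slice2 B b₁) ∧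
      (slice2 B b₁).card = R₂.det.natAbs ∧
      (proj2Set L).card = R₂.det.natAbs ∧
      IsHadamardTriple R₂ (slice2 B b₁) (proj2Set L)) ∧
    ((proj1Set B).card * R₂.det.natAbs = B.card ∧
      ∀ l₂ ∈ proj2Set L,
        (slice1 L l₂).card = (proj1Set B).card ∧
        IsHadamardTriple R₁ (proj1Set B) (slice1 L l₂)) := by
  subst hRdef
  have hd1 := det_ne_zero_of_expanding' R₁ hR₁
  have hd2 := det_ne_zero_of_expanding' R₂ hR₂
  have hu1 := isUnit_intMatCast_det' R₁ hd1
  have hu2 := isUnit_intMatCast_det' R₂ hd2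
  have hu2t : IsUnit ((intMatCast R₂)ᵀ).det := by rwa [Matrix.det_transpose]
  have hdR : (Matrix.fromBlocks R₁ 0 C R₂).det ≠ 0 := by
    rw [Matrix.det_fromBlocks_zero₁₂]; exact mul_ne_zero hd1 hd2
  have huRt : IsUnit (intMatCast (Matrix.fromBlocks R₁ 0 C R₂)ᵀ).det := by
    rw [intMatCast_transpose', Matrix.det_transpose]
    exact isUnit_intMatCast_det' _ hdR
  have hD : R₂.det.natAbs ≠ 0 := by simpa using hd2
  obtain ⟨hcard, hcol⟩ := hH
  have hcol' : ∀ b ∈ B, ∀ b' ∈ B, ∑ l ∈ L,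
      expv ((intMatCast (Matrix.fromBlocks R₁ 0 C R₂))⁻¹.mulVec (intVecCast b))
        (intVecCast l) *
      (starRingEnd ℂ) (expv ((intMatCast (Matrix.fromBlocks R₁ 0 C R₂))⁻¹.mulVec
        (intVecCast b')) (intVecCast l)) = if b = b' then (B.card : ℂ) else 0 := by
    intro b hb b' hb'
    have hN : (B.card : ℂ) ≠ 0 := by
      exact_mod_cast (Finset.card_pos.2 ⟨b, hb⟩).ne'
    have h := hcol b hb b' hb'
    rw [inv_mul_eq_iff_eq_mul₀ hN] at h
    rw [h]
    split_ifs <;> simp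
  -- column orthogonality within a slice of `B`
  have colK : ∀ b ∈ B, ∀ b' ∈ B, proj1 b = proj1 b' →
      ∑ l ∈ L, expv ((intMatCast R₂)⁻¹.mulVec (intVecCast (proj2 b - proj2 b')))
        (intVecCast (proj2 l)) = if b = b' then (B.card : ℂ) else 0 := by
    intro b hb b' hb' h1
    rw [← hcol' b hb b' hb']
    refine Finset.sum_congr rfl fun l _ => ?_
    have hz : proj1 (intVecCast b - intVecCast b') = 0 := by
      ext i
      have := congrFun h1 i
      simp only [proj1, Function.comp_apply] at this
      simp [proj1, intVecCast, this]
    rw [expv_mul_conj', ← Matrix.mulVec_sub, expv_split', intMatCast_blocks',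
      block_inv1' _ _ _ hu1 hu2, block_inv2' _ _ _ hu1 hu2 _ hz, hz, Matrix.mulVec_zero,
      expv_zero_left', one_mul, intVecCast_sub']
    rfl
  have hdist : ∀ b₁, ∀ b ∈ slice2 B b₁, ∀ b' ∈ slice2 B b₁, b - b' ∈ latt R₂ → b = b' := by
    intro b₁ c hc c' hc' hm
    obtain ⟨b, hb, hb1, rfl⟩ := mem_slice2' hc
    obtain ⟨b', hb', hb1', rfl⟩ := mem_slice2' hc'
    have h := colK b hb b' hb' (hb1.trans hb1'.symm)
    by_contra hne
    rw [if_neg (fun h => hne (by rw [h]))] at h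
    simp_rw [fun g => expv_of_mem_latt' R₂ hd2 _ g hm] at h
    simp at h
    rw [h] at hcard
    have := Finset.card_pos.2 ⟨b, hb⟩
    simp at hcard
    simp [hcard] at hb
  have hcomp : ∀ b₁ ∈ proj1Set B, IsCompleteResidueSet R₂ (slice2 B b₁) := by
    intro b₁ hb₁
    refine complete_of_vanishing' R₂ hd2 _ ?_ (fun b => expv (intVecCast b) y₀)
      (fun b => expv_ne_zero' _ _) (hdist b₁) ?_
    · obtain ⟨b, hb, rfl⟩ := Finset.mem_image.1 hb₁
      exact ⟨proj2 b, Finset.mem_image_of_mem _ (Finset.mem_filter.2 ⟨hb, rfl⟩)⟩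
    · intro g hg
      obtain ⟨l, ⟨hl, k, hk⟩, _⟩ := h𝓛 (Sum.elim 0 g)
      have hgl : g - proj2 l ∈ latt R₂ᵀ := by
        rw [mem_latt']
        refine ⟨proj2 k, ?_⟩
        have := congrArg proj2 hk
        rw [Matrix.fromBlocks_transpose, Matrix.fromBlocks_mulVec] at this
        ext i
        have := congrFun this i
        simpa [proj2] using this
      have hl2 : proj2 l ∉ latt R₂ᵀ := fun h => hg (by simpa using add_mem hgl h)
      have hzero : ∀ x : Fin r → ℝ, ∑ c ∈ proj1Set B,
          (∑ b₂ ∈ slice2 B c, expv (intVecCast b₂)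
            (y₀ + ((intMatCast R₂)ᵀ)⁻¹.mulVec (intVecCast (proj2 l)))) *
          expv (intVecCast c) x = 0 := by
        intro x
        set W : Fin s → ℝ := y₀ + ((intMatCast R₂)ᵀ)⁻¹.mulVec (intVecCast (proj2 l)) with hW
        let p : Fin r ⊕ Fin s → ℝ := Sum.elim x W
        let z : Fin r ⊕ Fin s → ℝ :=
          (intMatCast (Matrix.fromBlocks R₁ 0 C R₂)ᵀ).mulVec p - intVecCast l
        have hzl : (intMatCast (Matrix.fromBlocks R₁ 0 C R₂)ᵀ)⁻¹.mulVec
            (z + intVecCast l) = p := by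
          apply inv_mulVec_eq' _ huRt
          simp [z]
        have hz : z ∈ slabLevel r R₂ y₀ 1 := by
          refine ⟨0, ?_⟩
          have e0 : proj2 (intVecCast l) = intVecCast (proj2 l) := rfl
          have e1 : proj2 ((intMatCast (Matrix.fromBlocks R₁ 0 C R₂)ᵀ).mulVec p) =
              (intMatCast R₂)ᵀ.mulVec W := by
            rw [intMatCast_transpose', intMatCast_blocks', Matrix.fromBlocks_transpose,
              Matrix.fromBlocks_mulVec]
            simp [proj2, p]
          have e2 : proj2 (z - intVecCast 0) =
              proj2 ((intMatCast (Matrix.fromBlocks R₁ 0 C R₂)ᵀ).mulVec p) -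
              proj2 (intVecCast l) := by
            ext i; simp [proj2, z, intVecCast]
          rw [e2, e1, e0, hW, Matrix.mulVec_add, mulVec_inv' _ hu2t, pow_one,
            intMatCast_transpose']
          simp
        have hu0 : ¬ 0 < uB B p := by
          intro hpos
          have := htrans 1 le_rfl hm z hz l hl (by rw [hzl]; exact hpos)
          rw [hzl] at this
          obtain ⟨q, hq⟩ := this
          apply hl2
          rw [mem_latt']
          refine ⟨proj2 q, intVecCast_inj' ?_⟩
          have e3 : proj2 (p - intVecCast q) = W - intVecCast (proj2 q) := by
            ext i; simp [proj2, p, intVecCast]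
          rw [e3, hW] at hq
          simp only [Nat.sub_self, pow_zero, Matrix.one_mulVec] at hq
          have e4 : ((intMatCast R₂)ᵀ)⁻¹.mulVec (intVecCast (proj2 l)) =
              intVecCast (proj2 q) := by
            have := sub_eq_iff_eq_add.1 hq
            exact add_left_cancel this
          rw [intVecCast_mulVec', intMatCast_transpose', ← e4, mulVec_inv' _ hu2t]
        have hN : (B.card : ℂ) ≠ 0 := by
          obtain ⟨b, hb, _⟩ := Finset.mem_image.1 hb₁
          exact_mod_cast (Finset.card_pos.2 ⟨b, hb⟩).ne'
        have hs : ∑ b ∈ B, expv (intVecCast b) p = 0 := by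
          unfold uB at hu0
          by_contra hne
          apply hu0
          have : (B.card : ℂ)⁻¹ * ∑ b ∈ B, expv (intVecCast b) p ≠ 0 :=
            mul_ne_zero (inv_ne_zero hN) hne
          positivity
        rw [← hs]
        have := sum_proj1' B (fun c d => expv (intVecCast d) W * expv (intVecCast c) x)
        simp_rw [Finset.sum_mul]
        rw [← this]
        refine Finset.sum_congr rfl fun b _ => ?_
        rw [expv_split', mul_comm]
        rfl
      have h := expv_indep' _ (fun c => ∑ b₂ ∈ slice2 B c, expv (intVecCast b₂)
            (y₀ + ((intMatCast R₂)ᵀ)⁻¹.mulVec (intVecCast (proj2 l)))) hzero b₁ hb₁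
      rw [← h]
      refine Finset.sum_congr rfl fun b _ => ?_
      rw [expv_add_right', expv_transpose_inv', expv_congr_latt' R₂ hd2 _ _ _ hgl]
  have hc2 : ∀ b₁ ∈ proj1Set B, (slice2 B b₁).card = R₂.det.natAbs := fun b₁ hb₁ =>
    card_complete' R₂ hd2 _ (hcomp b₁ hb₁)
  have hprod : (proj1Set B).card * R₂.det.natAbs = B.card := by
    have h := sum_proj1' B (fun _ _ => 1)
    simp only [Finset.sum_const, nsmul_eq_mul, mul_one] at h
    rw [Finset.sum_congr rfl (fun b₁ hb₁ => by rw [hc2 b₁ hb₁])] at h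
    simp only [Finset.sum_const, nsmul_eq_mul] at h
    exact_mod_cast h.symm
  have hL2 : (proj2Set L).card ≤ R₂.det.natAbs := by
    rw [← Matrix.det_transpose]
    apply card_le_of_inj' R₂ᵀ (by rwa [Matrix.det_transpose])
    intro c hc c' hc' hm
    obtain ⟨l, hl, rfl⟩ := Finset.mem_image.1 hc
    obtain ⟨l', hl', rfl⟩ := Finset.mem_image.1 hc'
    exact hinjL l hl l' hl' ((mem_latt' _ _).1 hm)
  -- row orthogonality for the slices of `L`
  have hrow : B.Nonempty → ∀ l₂, ∀ c ∈ slice1 L l₂, ∀ c' ∈ slice1 L l₂,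
      ∑ b₁ ∈ proj1Set B, expv ((intMatCast R₁)⁻¹.mulVec (intVecCast b₁)) (intVecCast c) *
        (starRingEnd ℂ) (expv ((intMatCast R₁)⁻¹.mulVec (intVecCast b₁)) (intVecCast c')) =
      if c = c' then ((proj1Set B).card : ℂ) else 0 := by
    intro hBne l₂ c hc c' hc'
    obtain ⟨l, hl, rfl, hl2⟩ := mem_slice1' hc
    obtain ⟨l', hl', rfl, hl2'⟩ := mem_slice1' hc'
    have hN : (B.card : ℂ) ≠ 0 := by exact_mod_cast (Finset.card_pos.2 hBne).ne'
    have h := orth_swap' L B hcard (fun l b =>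
      expv ((intMatCast (Matrix.fromBlocks R₁ 0 C R₂))⁻¹.mulVec (intVecCast b))
        (intVecCast l)) _ hN hcol' l hl l' hl'
    have hz : proj2 (intVecCast l - intVecCast l') = 0 := by
      ext i
      have := congrFun (hl2.trans hl2'.symm) i
      simp only [proj2, Function.comp_apply] at this
      simp [proj2, intVecCast, this]
    have hz1 : proj1 (intVecCast l - intVecCast l') =
      intVecCast (proj1 l) - intVecCast (proj1 l') := rfl
    have h2 : ∑ b ∈ B, expv ((intMatCast R₁)⁻¹.mulVec (intVecCast (proj1 b)))
        (intVecCast (proj1 l) - intVecCast (proj1 l')) =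
        if l = l' then (B.card : ℂ) else 0 := by
      rw [← h]
      refine Finset.sum_congr rfl fun b _ => ?_
      rw [expv_mul_conj_right', expv_split', hz, expv_zero_right', mul_one,
        intMatCast_blocks', block_inv1' _ _ _ hu1 hu2, hz1]
      rfl
    rw [sum_proj1' B (fun c _ => expv ((intMatCast R₁)⁻¹.mulVec (intVecCast c))
        (intVecCast (proj1 l) - intVecCast (proj1 l')))] at h2
    simp only [Finset.sum_const, nsmul_eq_mul] at h2
    rw [Finset.sum_congr rfl (fun b₁ hb₁ => by rw [hc2 b₁ hb₁]), ← Finset.mul_sum,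
      ← hprod] at h2
    have hDc : (R₂.det.natAbs : ℂ) ≠ 0 := by exact_mod_cast hD
    simp_rw [expv_mul_conj_right']
    apply mul_left_cancel₀ hDc
    rw [h2]
    by_cases hll : l = l'
    · simp [hll, mul_comm]
    · have : proj1 l ≠ proj1 l' := fun h => hll (ext_proj' h (hl2.trans hl2'.symm))
      simp [hll, this]
  have hle : B.Nonempty → ∀ l₂, (slice1 L l₂).card ≤ (proj1Set B).card := by
    intro hBne l₂
    have hp : ((proj1Set B).card : ℂ) ≠ 0 := by
      have : (proj1Set B).Nonempty := hBne.image _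
      exact_mod_cast (Finset.card_pos.2 this).ne'
    exact orth_card' (slice1 L l₂) (proj1Set B)
      (fun c b₁ => expv ((intMatCast R₁)⁻¹.mulVec (intVecCast b₁)) (intVecCast c)) _ hp
      (hrow hBne l₂)
  have hsumL : ∑ l₂ ∈ proj2Set L, (slice1 L l₂).card = L.card := by
    have h := sum_proj2' L (fun _ _ => 1)
    simp only [Finset.sum_const, nsmul_eq_mul, mul_one] at h
    exact_mod_cast h.symm
  have hppos : B.Nonempty → 0 < (proj1Set B).card := fun h => Finset.card_pos.2 (h.image _)
  have hL2eq : B.Nonempty → (proj2Set L).card = R₂.det.natAbs := by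
    intro hBne
    refine le_antisymm hL2 ?_
    have h1 : L.card ≤ (proj2Set L).card * (proj1Set B).card := by
      rw [← hsumL, ← smul_eq_mul]
      exact Finset.sum_le_card_nsmul _ _ _ fun l₂ _ => hle hBne l₂
    rw [← hcard, ← hprod, mul_comm] at h1
    exact Nat.le_of_mul_le_mul_right h1 (hppos hBne)
  have hL1eq : B.Nonempty → ∀ l₂ ∈ proj2Set L, (slice1 L l₂).card = (proj1Set B).card := by
    intro hBne
    have h1 : ∑ l₂ ∈ proj2Set L, (slice1 L l₂).card =
        ∑ l₂ ∈ proj2Set L, (proj1Set B).card := by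
      rw [hsumL, Finset.sum_const, smul_eq_mul, hL2eq hBne, ← hcard, ← hprod, mul_comm]
    exact (Finset.sum_eq_sum_iff_of_le fun l₂ _ => hle hBne l₂).1 h1
  refine ⟨fun b₁ hb₁ => ?_, hprod, fun l₂ hl₂ => ?_⟩
  · have hBne : B.Nonempty := by
      obtain ⟨b, hb, _⟩ := Finset.mem_image.1 hb₁
      exact ⟨b, hb⟩
    refine ⟨hcomp b₁ hb₁, hc2 b₁ hb₁, hL2eq hBne, (hc2 b₁ hb₁).trans (hL2eq hBne).symm, ?_⟩
    intro c hc c' hc'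
    obtain ⟨b, hb, hb1, rfl⟩ := mem_slice2' hc
    obtain ⟨b', hb', hb1', rfl⟩ := mem_slice2' hc'
    have h := colK b hb b' hb' (hb1.trans hb1'.symm)
    rw [sum_proj2' L (fun _ d => expv ((intMatCast R₂)⁻¹.mulVec
      (intVecCast (proj2 b - proj2 b'))) (intVecCast d))] at h
    simp only [Finset.sum_const, nsmul_eq_mul] at h
    rw [Finset.sum_congr rfl (fun l₂ hl₂ => by rw [hL1eq hBne l₂ hl₂]), ← Finset.mul_sum,
      ← hprod] at h
    have hp : ((proj1Set B).card : ℂ) ≠ 0 := by exact_mod_cast (hppos hBne).ne'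
    have hDc : (R₂.det.natAbs : ℂ) ≠ 0 := by exact_mod_cast hD
    simp_rw [expv_mul_conj', ← Matrix.mulVec_sub, ← intVecCast_sub']
    rw [hc2 b₁ hb₁, inv_mul_eq_iff_eq_mul₀ hDc]
    apply mul_left_cancel₀ hp
    rw [h]
    by_cases hbb : b = b'
    · simp [hbb]
    · have : proj2 b ≠ proj2 b' := fun h => hbb (ext_proj' (hb1.trans hb1'.symm) h)
      simp [hbb, this]
  · have hBne : B.Nonempty := by
      obtain ⟨l, hl, _⟩ := Finset.mem_image.1 hl₂
      rw [← Finset.card_pos, hcard]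
      exact Finset.card_pos.2 ⟨l, hl⟩
    have hc1 := hL1eq hBne l₂ hl₂
    refine ⟨hc1, hc1.symm, ?_⟩
    have hp : ((proj1Set B).card : ℂ) ≠ 0 := by exact_mod_cast (hppos hBne).ne'
    have h := orth_swap' (proj1Set B) (slice1 L l₂) hc1
      (fun b₁ c => expv ((intMatCast R₁)⁻¹.mulVec (intVecCast b₁)) (intVecCast c)) _ hp
      (hrow hBne l₂)
    intro b hb b' hb'
    rw [inv_mul_eq_iff_eq_mul₀ hp, h b hb b' hb']
    split_ifs <;> simp

end
end

section
/- Let n ≥ 1, let R₂ be an n×n expanding integer matrix (all eigenvalues of modulus strictly greater than 1), let m ≥ 1, and let y₀ ∈ ℝ^n satisfy (R₂ᵀ)^m y₀ − y₀ ∈ ℤ^n and y₀ ∉ ℤ^n. Write y_j = (R₂ᵀ)^j y₀ and define Γ = {x ∈ ℤ^n : ⟨x, (R₂ᵀ)⁻¹ y_j⟩ ∈ ℤ for all 1 ≤ j ≤ m}. Then Γ is a subgroup of ℤ^n of full rank n, Γ ≠ ℤ^n, and R₂(Γ) ⊆ Γ. Consequently, Γ = Q(ℤ^n) for an invertible integer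 matrix Q with |det Q| ≥ 2, and R₂Q = Q R̃₂ for some n×n integer matrix R̃₂. -/
open MeasureTheory Matrix Filter
open scoped BigOperators Classical

noncomputable section

variable {ι : Type*}

theorem aux_det_ne {n : ℕ} (R : Matrix (Fin n) (Fin n) ℤ) (hR : IsExpanding R) : R.det ≠ 0 := by
  intro h
  have h0 : (0 : ℂ) ∈ spectrum ℂ (R.map (Int.cast : ℤ → ℂ)) := by
    rw [spectrum.zero_mem_iff, Matrix.isUnit_iff_isUnit_det]
    have : (R.map (Int.cast : ℤ → ℂ)).det = ((R.det : ℤ) : ℂ) := by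
      have := (Int.castRingHom ℂ).map_det R
      simpa using this.symm
    rw [this, h]; simp
  have := hR 0 h0
  norm_num at this

theorem aux_det_pow_ne {n : ℕ} (R : Matrix (Fin n) (Fin n) ℤ) (hR : IsExpanding R)
    (m : ℕ) (hm : 1 ≤ m) : (R ^ m - 1).det ≠ 0 := by
  intro h
  have h0 : (1 : ℂ) ∈ spectrum ℂ ((R.map (Int.cast : ℤ → ℂ)) ^ m) := by
    rw [spectrum.mem_iff, Matrix.isUnit_iff_isUnit_det, ← neg_sub, Matrix.det_neg]
    have : ((R.map (Int.cast : ℤ → ℂ)) ^ m - algebraMap ℂ _ 1).det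
        = (((R ^ m - 1).det : ℤ) : ℂ) := by
      have := (Int.castRingHom ℂ).map_det (R ^ m - 1)
      rw [map_sub, map_pow, map_one] at this
      simpa using this.symm
    rw [this, h]; simp
  rw [spectrum.map_pow_of_pos _ (by omega)] at h0
  obtain ⟨z, hz, hz1⟩ := h0
  have h1 := hR z hz
  have h2 : ‖z‖ ^ m = 1 := by
    rw [← norm_pow]
    have : z ^ m = 1 := hz1
    simp [this]
  have := one_lt_pow₀ h1 (show m ≠ 0 by omega)
  linarith

theorem aux_cast_mulVec {n : ℕ} (M : Matrix (Fin n) (Fin n) ℤ) (k : Fin n → ℤ) :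
    (intMatCast M).mulVec (intVecCast k) = intVecCast (M.mulVec k) := by
  funext i
  simp [intMatCast, intVecCast, Matrix.mulVec, dotProduct]

theorem aux_cast_dot {n : ℕ} (x k : Fin n → ℤ) :
    intVecCast x ⬝ᵥ intVecCast k = ((x ⬝ᵥ k : ℤ) : ℝ) := by
  simp [intVecCast, dotProduct]

theorem aux_cast_eq {n : ℕ} (M : Matrix (Fin n) (Fin n) ℤ) :
    intMatCast M = (Int.castRingHom ℝ).mapMatrix M := rfl

theorem aux_lattice {n : ℕ} (N : Submodule ℤ (Fin n → ℤ)) (d : ℤ) (hd : d ≠ 0)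
    (hN : ∀ x, d • x ∈ N) (hne : (N : Set (Fin n → ℤ)) ≠ Set.univ)
    (R : Matrix (Fin n) (Fin n) ℤ) (hR : ∀ x ∈ N, R.mulVec x ∈ N) :
    ∃ Q : Matrix (Fin n) (Fin n) ℤ,
      (N : Set (Fin n → ℤ)) = Set.range (fun w => Q.mulVec w) ∧
      2 ≤ Q.det.natAbs ∧
      ∃ Rt : Matrix (Fin n) (Fin n) ℤ, R * Q = Q * Rt := by
  obtain ⟨r, ⟨b⟩⟩ := Submodule.nonempty_basis_of_pid (Pi.basisFun ℤ (Fin n)) N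
  have hr : r = n := by
    have h1 : Module.finrank ℤ N = r := by simpa using Module.finrank_eq_card_basis b
    have h2 : Module.finrank ℤ N ≤ n := by simpa using Submodule.finrank_le N
    let f : (Fin n → ℤ) →ₗ[ℤ] N := LinearMap.codRestrict N (d • LinearMap.id) (fun x => hN x)
    have hf : Function.Injective f := by
      intro x y hxy
      have : d • x = d • y := congrArg Subtype.val hxy
      exact smul_right_injective _ hd this
    have : Module.Finite ℤ N := Module.Finite.of_basis b
    have h3 := LinearMap.finrank_le_finrank_of_injective hf
    simp at h3
    omega
  subst hr
  let Q : Matrix (Fin r) (Fin r) ℤ := Matrix.of fun i j => (b j : Fin r → ℤ) i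
  have hQ : ∀ w, Q.mulVec w = ((∑ j, w j • b j : N) : Fin r → ℤ) := by
    intro w
    funext i
    simp [Q, Matrix.mulVec, dotProduct, mul_comm]
  have hrange : (N : Set (Fin r → ℤ)) = Set.range (fun w => Q.mulVec w) := by
    ext x
    constructor
    · intro hx
      refine ⟨b.repr ⟨x, hx⟩, ?_⟩
      change Q.mulVec _ = x
      rw [hQ, b.sum_repr]
    · rintro ⟨w, rfl⟩
      change Q.mulVec w ∈ N
      rw [hQ]
      exact Subtype.property _
  have hlift : ∀ M : Matrix (Fin r) (Fin r) ℤ, (∀ j, M.col j ∈ N) → ∃ W, M = Q * W := by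
    intro M hM
    have : ∀ j, ∃ w, Q.mulVec w = M.col j := fun j => by
      have := hM j
      rw [← SetLike.mem_coe, hrange] at this
      exact this
    choose w hw using this
    refine ⟨Matrix.of fun i j => w j i, ?_⟩
    ext i j
    have := congrFun (hw j) i
    simp only [Matrix.col_apply] at this
    rw [← this]
    rfl
  refine ⟨Q, hrange, ?_, ?_⟩
  · obtain ⟨W, hW⟩ := hlift (d • 1) (fun j => by
      have := hN ((1 : Matrix (Fin r) (Fin r) ℤ).col j)
      exact this)
    have h0 : Q.det ≠ 0 := by
      intro h
      have := congrArg Matrix.det hW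
      rw [Matrix.det_mul, h, Matrix.det_smul] at this
      simp [hd] at this
    have h1 : ¬ IsUnit Q.det := by
      intro h
      apply hne
      rw [hrange, Set.eq_univ_iff_forall]
      intro x
      refine ⟨Q⁻¹.mulVec x, ?_⟩
      simp [Matrix.mulVec_mulVec, Matrix.mul_nonsing_inv Q h]
    rw [Int.isUnit_iff_natAbs_eq] at h1
    have := Int.natAbs_ne_zero.mpr h0
    omega
  · apply hlift
    intro j
    have : (R * Q).col j = R.mulVec (b j) := by
      funext i
      rfl
    rw [this]
    exact hR _ (b j).2

/-- The lattice `Γ = {x ∈ ℤ^n : ⟨x,(R₂ᵀ)⁻¹y_j⟩ ∈ ℤ for 1 ≤ j ≤ m}` is a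
proper full-rank `R₂`-invariant subgroup of `ℤ^n`, hence `Γ = Q(ℤ^n)` with `|det Q| ≥ 2`
and `R₂Q = QR̃₂`. -/
theorem lattice_gamma_structure {n : ℕ} (hn : 1 ≤ n)
    (R₂ : Matrix (Fin n) (Fin n) ℤ) (hR₂ : IsExpanding R₂)
    (m : ℕ) (hm : 1 ≤ m) (y₀ : Fin n → ℝ)
    (hy₀ : ∃ k : Fin n → ℤ, ((intMatCast R₂ᵀ) ^ m).mulVec y₀ - y₀ = intVecCast k)
    (hy₀' : ¬∃ k : Fin n → ℤ, y₀ = intVecCast k)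
    (Γ : Set (Fin n → ℤ))
    (hΓ : Γ = {x | ∀ j, 1 ≤ j → j ≤ m → ∃ z : ℤ,
      rdot (intVecCast x)
        ((intMatCast R₂ᵀ)⁻¹.mulVec (((intMatCast R₂ᵀ) ^ j).mulVec y₀)) = (z : ℝ)}) :
    (0 ∈ Γ) ∧ (∀ x ∈ Γ, ∀ y ∈ Γ, x + y ∈ Γ) ∧ (∀ x ∈ Γ, -x ∈ Γ) ∧
    (∃ v : Fin n → Fin n → ℤ, (∀ i, v i ∈ Γ) ∧
      LinearIndependent ℚ (fun i => fun j => ((v i j : ℚ)))) ∧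
    Γ ≠ Set.univ ∧
    (∀ x ∈ Γ, R₂.mulVec x ∈ Γ) ∧
    ∃ Q : Matrix (Fin n) (Fin n) ℤ,
      Γ = Set.range (fun w => Q.mulVec w) ∧
      2 ≤ Q.det.natAbs ∧
      ∃ Rt₂ : Matrix (Fin n) (Fin n) ℤ, R₂ * Q = Q * Rt₂ := by
  obtain ⟨k, hk⟩ := hy₀
  set A' := intMatCast R₂ᵀ with hA'
  have hdetA : IsUnit A'.det := by
    have : A'.det = ((R₂.det : ℤ) : ℝ) := by
      rw [hA', aux_cast_eq, ← RingHom.map_det, Matrix.det_transpose]; rfl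
    rw [this]
    exact isUnit_iff_ne_zero.mpr (by exact_mod_cast aux_det_ne R₂ hR₂)
  have hmem : ∀ x, x ∈ Γ ↔ ∀ i < m, ∃ z : ℤ, intVecCast x ⬝ᵥ ((A' ^ i).mulVec y₀) = (z : ℝ) := by
    have key : ∀ i, A'⁻¹.mulVec ((A' ^ (i + 1)).mulVec y₀) = (A' ^ i).mulVec y₀ := by
      intro i
      rw [Matrix.mulVec_mulVec, pow_succ', ← Matrix.mul_assoc, Matrix.nonsing_inv_mul _ hdetA,
        Matrix.one_mul]
    intro x
    rw [hΓ]
    constructor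
    · intro h i hi
      have := h (i + 1) (by omega) (by omega)
      rw [key] at this
      exact this
    · intro h j hj hjm
      obtain ⟨i, rfl⟩ : ∃ i, j = i + 1 := ⟨j - 1, by omega⟩
      rw [key]
      exact h i (by omega)
  have hadd : ∀ x y : Fin n → ℤ, intVecCast (x + y) = intVecCast x + intVecCast y := by
    intro x y; funext i; simp [intVecCast]
  have hneg : ∀ x : Fin n → ℤ, intVecCast (-x) = -intVecCast x := by
    intro x; funext i; simp [intVecCast]
  have c0 : (0 : Fin n → ℤ) ∈ Γ := by
    rw [hmem]
    intro i _
    refine ⟨0, ?_⟩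
    have : intVecCast (0 : Fin n → ℤ) = 0 := by funext i; simp [intVecCast]
    simp [this]
  have cadd : ∀ x ∈ Γ, ∀ y ∈ Γ, x + y ∈ Γ := by
    intro x hx y hy
    rw [hmem] at *
    intro i hi
    obtain ⟨a, ha⟩ := hx i hi
    obtain ⟨b, hb⟩ := hy i hi
    exact ⟨a + b, by rw [hadd, add_dotProduct, ha, hb]; push_cast; rfl⟩
  have cneg : ∀ x ∈ Γ, -x ∈ Γ := by
    intro x hx
    rw [hmem] at *
    intro i hi
    obtain ⟨a, ha⟩ := hx i hi
    exact ⟨-a, by rw [hneg, neg_dotProduct, ha]; push_cast; rfl⟩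
  have cne : Γ ≠ Set.univ := by
    intro h
    apply hy₀'
    have : ∀ i, ∃ z : ℤ, y₀ i = z := by
      intro i
      have h1 : (Pi.single i 1 : Fin n → ℤ) ∈ Γ := by rw [h]; trivial
      obtain ⟨z, hz⟩ := (hmem _).1 h1 0 (by omega)
      refine ⟨z, ?_⟩
      have h2 : intVecCast (Pi.single i 1 : Fin n → ℤ) = Pi.single i 1 := by
        funext j
        by_cases hj : j = i
        · subst hj; simp [intVecCast]
        · simp [intVecCast, hj]
      rw [h2] at hz
      simpa using hz
    choose z hz using this
    exact ⟨z, funext hz⟩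
  have cR : ∀ x ∈ Γ, R₂.mulVec x ∈ Γ := by
    intro x hx
    rw [hmem] at *
    intro i hi
    have h1 : intVecCast (R₂.mulVec x) ⬝ᵥ ((A' ^ i).mulVec y₀)
        = intVecCast x ⬝ᵥ ((A' ^ (i + 1)).mulVec y₀) := by
      have h2 : intMatCast R₂ = A'ᵀ := rfl
      rw [← aux_cast_mulVec, h2, pow_succ', ← Matrix.mulVec_mulVec, Matrix.mulVec_transpose,
        ← Matrix.dotProduct_mulVec]
    rw [h1]
    by_cases him : i + 1 < m
    · exact hx _ him
    · have : i + 1 = m := by omega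
      rw [this, sub_eq_iff_eq_add.mp hk, dotProduct_add, aux_cast_dot]
      obtain ⟨z, hz⟩ := hx 0 (by omega)
      rw [pow_zero, Matrix.one_mulVec] at hz
      exact ⟨x ⬝ᵥ k + z, by rw [hz]; push_cast; rfl⟩
  obtain ⟨d, hd, hdy⟩ : ∃ d : ℤ, d ≠ 0 ∧ ∃ l : Fin n → ℤ, (d : ℝ) • y₀ = intVecCast l := by
    refine ⟨(R₂ᵀ ^ m - 1).det, ?_, (R₂ᵀ ^ m - 1).adjugate.mulVec k, ?_⟩
    · rw [← Matrix.transpose_pow, ← Matrix.transpose_one, ← Matrix.transpose_sub,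
        Matrix.det_transpose]
      exact aux_det_pow_ne R₂ hR₂ m hm
    · have h1 : intMatCast (R₂ᵀ ^ m - 1) = A' ^ m - 1 := by
        rw [aux_cast_eq, map_sub, map_pow, map_one]; rfl
      have h2 : intMatCast (R₂ᵀ ^ m - 1).adjugate * (A' ^ m - 1)
          = (((R₂ᵀ ^ m - 1).det : ℤ) : ℝ) • (1 : Matrix (Fin n) (Fin n) ℝ) := by
        rw [← h1, aux_cast_eq, aux_cast_eq, ← map_mul, Matrix.adjugate_mul]
        generalize (R₂ᵀ ^ m - 1).det = e
        ext i j
        rw [RingHom.mapMatrix_apply, Matrix.map_apply, Matrix.smul_apply, Matrix.smul_apply,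
          Matrix.one_apply, Matrix.one_apply]
        by_cases hij : i = j <;> simp [hij]
      rw [← aux_cast_mulVec, ← hk]
      have h3 : (A' ^ m).mulVec y₀ - y₀ = (A' ^ m - 1).mulVec y₀ := by
        rw [Matrix.sub_mulVec, Matrix.one_mulVec]
      rw [h3, Matrix.mulVec_mulVec, h2, Matrix.smul_mulVec, Matrix.one_mulVec]
  obtain ⟨l, hl⟩ := hdy
  have cd : ∀ x : Fin n → ℤ, d • x ∈ Γ := by
    intro x
    rw [hmem]
    intro i _
    refine ⟨x ⬝ᵥ (R₂ᵀ ^ i).mulVec l, ?_⟩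
    have h1 : intVecCast (d • x) = (d : ℝ) • intVecCast x := by
      funext j; simp [intVecCast]
    have h2 : A' ^ i = intMatCast (R₂ᵀ ^ i) := by
      rw [aux_cast_eq, map_pow]; rfl
    rw [h1, smul_dotProduct, ← dotProduct_smul, ← Matrix.mulVec_smul, hl, h2, aux_cast_mulVec,
      aux_cast_dot]
  let N : Submodule ℤ (Fin n → ℤ) := AddSubgroup.toIntSubmodule
    { carrier := Γ, add_mem' := fun {a b} ha hb => cadd a ha b hb, zero_mem' := c0,
      neg_mem' := fun {a} ha => cneg a ha }
  refine ⟨c0, cadd, cneg, ⟨fun i => d • Pi.single i 1, fun i => cd _, ?_⟩, cne, cR,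
    aux_lattice N d hd cd cne R₂ cR⟩
  rw [Fintype.linearIndependent_iff]
  intro g hg i
  have := congrFun hg i
  simpa [Finset.sum_apply, Pi.single_apply, hd] using this

end
end

section
/- Let n ≥ 1, let T ⊂ [0,1] × ℝ^n be a Lebesgue-measurable set, and let Γ* be a subgroup of ℤ^{1+n} such that the translates {T + γ : γ ∈ Γ*} tile ℝ^{1+n}, i.e. Σ_{γ ∈ Γ*} 1_{T+γ}(x) = 1 for Lebesgue-almost every x ∈ ℝ^{1+n}. Define Γ̃ = {y ∈ ℤ^n : (0,y) ∈ Γ*}. Then the translates {T + (k,γ) : k ∈ ℤ, γ ∈ Γ̃} tile ℝ^{1+n}, i.e. Σ_{k ∈ ℤ, γ ∈ Γ̃} 1_{T+(k,γ)}(x) = 1 for Lebesgue-almost every x ∈ ℝ^{1+n}. -/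
open MeasureTheory Matrix Filter
open scoped BigOperators Classical

noncomputable section

variable {ι : Type*}

open scoped ENNReal

/-- If `T ⊆ [0,1] × ℝ^n` tiles `ℝ^{1+n}` by a subgroup `Γ*` of `ℤ^{1+n}`,
then it also tiles by `ℤ × Γ̃` where `Γ̃ = {y : (0,y) ∈ Γ*}`. -/
theorem cylinder_tiling {n : ℕ} (hn : 1 ≤ n)
    (T : Set (ℝ × (Fin n → ℝ))) (hTmeas : MeasurableSet T)
    (hTsub : T ⊆ Set.Icc (0 : ℝ) 1 ×ˢ (Set.univ : Set (Fin n → ℝ)))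
    (Γstar : AddSubgroup (ℤ × (Fin n → ℤ)))
    (htile : ∀ᵐ x ∂(volume : Measure (ℝ × (Fin n → ℝ))),
      ∑' γ : Γstar, T.indicator (fun _ => (1 : ℝ≥0∞))
        (x - (((γ : ℤ × (Fin n → ℤ)).1 : ℝ), intVecCast (γ : ℤ × (Fin n → ℤ)).2)) = 1) :
    ∀ᵐ x ∂(volume : Measure (ℝ × (Fin n → ℝ))),
      ∑' p : ℤ × {y : Fin n → ℤ // ((0, y) : ℤ × (Fin n → ℤ)) ∈ Γstar},
        T.indicator (fun _ => (1 : ℝ≥0∞)) (x - ((p.1 : ℝ), intVecCast p.2.val)) = 1 := by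
  have h1 : ∀ᵐ x ∂(volume : Measure (ℝ × (Fin n → ℝ))), ∀ k : ℤ,
      ∑' γ : Γstar, T.indicator (fun _ => (1 : ℝ≥0∞))
        ((x - ((k : ℝ), (0 : Fin n → ℝ))) -
          (((γ : ℤ × (Fin n → ℤ)).1 : ℝ), intVecCast (γ : ℤ × (Fin n → ℤ)).2)) = 1 := by
    rw [ae_all_iff]
    intro k
    haveI : (volume : Measure (ℝ × (Fin n → ℝ))).IsAddRightInvariant := by
      rw [Measure.volume_eq_prod]
      infer_instance
    exact (measurePreserving_sub_right (volume : Measure (ℝ × (Fin n → ℝ)))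
      ((k : ℝ), (0 : Fin n → ℝ))).quasiMeasurePreserving.ae htile
  have h2 : ∀ᵐ x ∂(volume : Measure (ℝ × (Fin n → ℝ))), x.1 ∉ Set.range (Int.cast : ℤ → ℝ) := by
    have h0 : ∀ᵐ t ∂(volume : Measure ℝ), t ∉ Set.range (Int.cast : ℤ → ℝ) :=
      (Set.countable_range (Int.cast : ℤ → ℝ)).ae_notMem volume
    exact (Measure.quasiMeasurePreserving_fst
      (μ := (volume : Measure ℝ)) (ν := (volume : Measure (Fin n → ℝ)))).ae h0
  filter_upwards [h1, h2] with x hx hxi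
  have hfl : ((⌊x.1⌋ : ℤ) : ℝ) < x.1 :=
    lt_of_le_of_ne (Int.floor_le _) (fun h => hxi ⟨_, h⟩)
  have hfl2 := Int.lt_floor_add_one x.1
  -- only one level of the first coordinate can contribute
  have key : ∀ (m : ℤ) (v : Fin n → ℝ), (x.1 - (m : ℝ), v) ∈ T → m = ⌊x.1⌋ := by
    intro m v hm
    have h := (hTsub hm).1
    simp only [Set.mem_Icc] at h
    have ha : m ≤ ⌊x.1⌋ := Int.le_floor.2 (by linarith)
    have hb : (⌊x.1⌋ : ℝ) < (m : ℝ) + 1 := by linarith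
    have hb' : ⌊x.1⌋ < m + 1 := by exact_mod_cast hb
    omega
  refine Eq.trans ?_ (hx ⌊x.1⌋)
  let i : {y : Fin n → ℤ // ((0, y) : ℤ × (Fin n → ℤ)) ∈ Γstar} →
      ℤ × {y : Fin n → ℤ // ((0, y) : ℤ × (Fin n → ℤ)) ∈ Γstar} := fun y => (⌊x.1⌋, y)
  let j : {y : Fin n → ℤ // ((0, y) : ℤ × (Fin n → ℤ)) ∈ Γstar} → Γstar :=
    fun y => ⟨(0, y.1), y.2⟩
  have hi : Function.Injective i := fun a b h => (Prod.ext_iff.1 h).2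
  have hj : Function.Injective j := fun a b h =>
    Subtype.ext (Prod.ext_iff.1 (Subtype.ext_iff.1 h)).2
  rw [← hi.tsum_eq, ← hj.tsum_eq]
  · refine tsum_congr fun y => ?_
    have he : x - (((i y).1 : ℝ), intVecCast (i y).2.val) =
        x - ((⌊x.1⌋ : ℝ), (0 : Fin n → ℝ)) -
          (((j y : ℤ × (Fin n → ℤ)).1 : ℝ), intVecCast (j y : ℤ × (Fin n → ℤ)).2) := by
      refine Prod.ext ?_ ?_ <;> simp [i, j]
    rw [he]
  · rintro ⟨γ, hγ⟩ h
    have hmem := Set.mem_of_indicator_ne_zero h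
    have h3 := key (⌊x.1⌋ + γ.1) (x.2 - 0 - intVecCast γ.2) (by
      convert hmem using 1
      ext
      · simp [sub_sub]
      · simp)
    have h4 : γ.1 = 0 := by omega
    obtain ⟨a, b⟩ := γ
    simp only at h4
    subst h4
    exact ⟨⟨b, hγ⟩, rfl⟩
  · rintro ⟨m, y⟩ h
    have hmem := Set.mem_of_indicator_ne_zero h
    have h3 := key m _ hmem
    exact ⟨y, by simp [i, h3]⟩

end
end
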